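/- arXiv:2412.15217 — 5 statements merged into one kernel-verified Lean document; each statement's English description precedes it below -/
import Mathlib

section
/- Let $q_1 < q_2 < \ldots < q_n$ ($n \geq 3$) be an increasing sequence of pairwise relatively prime positive integers, and let $P = \prod_{1 \leq i < j \leq n}(q_j - q_i)$. Then for any $k$ with $1 < k < n$, the sequence $P+q_1, \ldots, P+q_n$ is a $(k,n)$-Mignotte sequence; that is, the numbers $P+q_1 < \ldots < P+q_n$ are pairwise relatively prime positive integers and $\prod_{i=1}^{k}(P+q_i) > \prod_{j=n-k+2}^{n}(P+q_j)$. -/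
open Finset in
theorem prod_lt_prod_of_two_pow_lt {ι : Type*} {s t : Finset ι} {f : ι → ℕ} {a m : ℕ}
    (hs : #s = m + 1) (ht : #t = m) (ha : 2 ^ m < a)
    (hlow : ∀ i ∈ s, a ≤ f i) (hupp : ∀ j ∈ t, f j ≤ 2 * a) :
    ∏ j ∈ t, f j < ∏ i ∈ s, f i :=
  calc ∏ j ∈ t, f j ≤ (2 * a) ^ m := ht ▸ prod_le_pow_card t f _ hupp
    _ = 2 ^ m * a ^ m := mul_pow _ _ _
    _ < a * a ^ m := Nat.mul_lt_mul_of_pos_right ha (pow_pos (Nat.zero_lt_of_lt ha) _)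
    _ = a ^ (m + 1) := (pow_succ' a m).symm
    _ ≤ ∏ i ∈ s, f i := hs ▸ pow_card_le_prod s f _ hlow

theorem coprime_add_of_sub_dvd {a b P : ℕ} (h : Nat.Coprime a b)
    (hP : b - a ∣ P) : Nat.Coprime (P + a) (P + b) := by
  refine Nat.Coprime.symm (Nat.coprime_of_dvd fun p hp hb ha => hp.one_lt.ne' ?_)
  have hsub : p ∣ b - a := by
    simpa [Nat.add_sub_add_left] using Nat.dvd_sub hb ha
  have hpP := hsub.trans hP
  exact Nat.eq_one_of_dvd_coprimes h ((Nat.dvd_add_right hpP).1 ha)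
    ((Nat.dvd_add_right hpP).1 hb)

theorem mignotte_construction
    (n : ℕ) (hn : 3 ≤ n) (q : ℕ → ℕ)
    (hpos : ∀ i, 1 ≤ i → i ≤ n → 0 < q i)
    (hmono : ∀ i j, 1 ≤ i → i < j → j ≤ n → q i < q j)
    (hcop : ∀ i j, 1 ≤ i → i < j → j ≤ n → Nat.Coprime (q i) (q j))
    (P : ℕ)
    (hP : P = ∏ p ∈ (Finset.Icc 1 n ×ˢ Finset.Icc 1 n).filter (fun p => p.1 < p.2),
        (q p.2 - q p.1))
    (k : ℕ) (hk1 : 1 < k) (hkn : k < n) :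
    (∀ i, 1 ≤ i → i ≤ n → 0 < P + q i) ∧
    (∀ i j, 1 ≤ i → i < j → j ≤ n → P + q i < P + q j) ∧
    (∀ i j, 1 ≤ i → i < j → j ≤ n → Nat.Coprime (P + q i) (P + q j)) ∧
    (∏ i ∈ Finset.Icc 1 k, (P + q i)) > (∏ j ∈ Finset.Icc (n - k + 2) n, (P + q j)) := by
  have hdvd : ∀ i j, 1 ≤ i → i < j → j ≤ n → q j - q i ∣ P := by
    intro i j hi hij hj
    rw [hP]
    exact Finset.dvd_prod_of_mem (fun p : ℕ × ℕ => q p.2 - q p.1) (a := (i, j))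
      (by simp; omega)
  have hfactor : ∀ p ∈ (Finset.Icc 1 n ×ˢ Finset.Icc 1 n).filter (fun p => p.1 < p.2),
      1 ≤ q p.2 - q p.1 := by
    intro p hp
    simp only [Finset.mem_filter, Finset.mem_product, Finset.mem_Icc] at hp
    have := hmono p.1 p.2 (by omega) (by omega) (by omega)
    omega
  have hpow : 2 ^ (n - 2) ≤ P :=
    calc 2 ^ (n - 2) = 2 ^ ({1} ×ˢ Finset.Icc 3 n : Finset (ℕ × ℕ)).card := by
          congr 1; simp
      _ ≤ ∏ p ∈ {1} ×ˢ Finset.Icc 3 n, (q p.2 - q p.1) := by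
          refine Finset.pow_card_le_prod _ _ _ fun p hp => ?_
          simp only [Finset.mem_product, Finset.mem_singleton, Finset.mem_Icc] at hp
          have h12 := hmono 1 2 (by omega) (by omega) (by omega)
          have h2p := hmono 2 p.2 (by omega) (by omega) (by omega)
          rw [hp.1]
          omega
      _ ≤ P := by
          rw [hP]
          refine Finset.prod_le_prod_of_subset_of_one_le' (fun p hp => ?_)
            fun p hp _ => hfactor p hp
          simp only [Finset.mem_product, Finset.mem_singleton, Finset.mem_Icc,
            Finset.mem_filter] at hp ⊢
          omega
  have hPpos : 0 < P := (Nat.two_pow_pos _).trans_le hpow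
  have hq1 := hpos 1 le_rfl (by omega)
  refine ⟨fun i _ _ => by omega, fun i j hi hij hj => by
    have := hmono i j hi hij hj
    omega, fun i j hi hij hj => coprime_add_of_sub_dvd
      (hcop i j hi hij hj) (hdvd i j hi hij hj), ?_⟩
  refine prod_lt_prod_of_two_pow_lt (a := P + q 1) (m := k - 1) (by simp; omega)
    (by simp; omega) ?_ (fun i hi => ?_) fun j hj => ?_
  · have : 2 ^ (k - 1) ≤ 2 ^ (n - 2) := Nat.pow_le_pow_right (by norm_num) (by omega)
    omega
  · rw [Finset.mem_Icc] at hi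
    rcases hi.1.eq_or_lt with rfl | h
    · rfl
    · have := hmono 1 i le_rfl h (by omega)
      omega
  · rw [Finset.mem_Icc] at hj
    have := Nat.le_of_dvd hPpos (hdvd 1 j le_rfl (by omega) hj.2)
    omega
end

section
/- Let $q_1 < q_2 < \ldots < q_n$ ($n \geq 3$) be an increasing sequence of pairwise relatively prime positive integers, and let $P = \prod_{1 \leq i < j \leq n}(q_j - q_i)$. Then the numbers $P+q_1, \ldots, P+q_n$ are pairwise relatively prime, i.e., $\gcd(P+q_i, P+q_j) = 1$ for all $1 \leq i < j \leq n$. -/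
theorem shifted_pairwise_coprime
    (n : ℕ) (hn : 3 ≤ n) (q : ℕ → ℕ)
    (hpos : ∀ i, 1 ≤ i → i ≤ n → 0 < q i)
    (hmono : ∀ i j, 1 ≤ i → i < j → j ≤ n → q i < q j)
    (hcop : ∀ i j, 1 ≤ i → i < j → j ≤ n → Nat.Coprime (q i) (q j))
    (P : ℕ)
    (hP : P = ∏ p ∈ (Finset.Icc 1 n ×ˢ Finset.Icc 1 n).filter (fun p => p.1 < p.2),
        (q p.2 - q p.1)) :
    ∀ i j, 1 ≤ i → i < j → j ≤ n → Nat.gcd (P + q i) (P + q j) = 1 := by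
  intro i j hi hij hj
  have hd : q j - q i ∣ P := by
    rw [hP]
    exact Finset.dvd_prod_of_mem (fun p : ℕ × ℕ => q p.2 - q p.1) (a := (i, j))
      (by simp only [Finset.mem_filter, Finset.mem_product, Finset.mem_Icc]; omega)
  have hgi := Nat.gcd_dvd_left (P + q i) (P + q j)
  have hgj := Nat.gcd_dvd_right (P + q i) (P + q j)
  have hgP : Nat.gcd (P + q i) (P + q j) ∣ P := by
    refine dvd_trans ?_ hd
    have h := Nat.dvd_sub hgj hgi
    rwa [Nat.add_sub_add_left] at h
  exact Nat.eq_one_of_dvd_coprimes (hcop i j hi hij hj)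
    ((Nat.dvd_add_right hgP).1 hgi) ((Nat.dvd_add_right hgP).1 hgj)
end

section
/- Let $q_1 < q_2 < \ldots < q_n$ ($n \geq 3$) be an increasing sequence of pairwise relatively prime positive integers, and let $P = \prod_{1 \leq i < j \leq n}(q_j - q_i)$. Then for any $k$ with $1 < k < n$, we have $\prod_{i=1}^{k}(P+q_i) > \prod_{j=n-k+2}^{n}(P+q_j)$. -/
/-- If `m * (B - A) ≤ A`, then `B ^ j < A ^ (j + 1)` for all `j ≤ m`, provided `3 ≤ A`. -/
theorem pow_lt_pow_succ_of_mul_le {A B m j : ℕ} (hA : 3 ≤ A) (hm : 0 < m) (hj : j ≤ m)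
    (hB : m * B ≤ (m + 1) * A) : B ^ j < A ^ (j + 1) := by
  have hm' : (0 : ℝ) < m := by exact_mod_cast hm
  have hA' : (3 : ℝ) ≤ A := by exact_mod_cast hA
  have hBA : (B : ℝ) ≤ A * Real.exp (1 / m) := by
    have h1 : (m : ℝ) * B ≤ (m + 1) * A := by exact_mod_cast hB
    calc (B : ℝ) ≤ A * (1 / m + 1) := by
          field_simp
          linarith
      _ ≤ A * Real.exp (1 / m) := by gcongr; exact Real.add_one_le_exp _
  have hexp : Real.exp (1 / m) ^ j < 3 := by
    rw [← Real.exp_nat_mul]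
    refine lt_of_le_of_lt (Real.exp_le_exp.mpr ?_) Real.exp_one_lt_three
    rw [mul_one_div, div_le_one hm']
    exact_mod_cast hj
  have : (B : ℝ) ^ j < (A : ℝ) ^ (j + 1) := by
    calc (B : ℝ) ^ j ≤ (A * Real.exp (1 / m)) ^ j := by gcongr
      _ = A ^ j * Real.exp (1 / m) ^ j := mul_pow _ _ _
      _ < A ^ j * A := by gcongr; linarith
      _ = A ^ (j + 1) := (pow_succ _ _).symm
  exact_mod_cast this

theorem add_sub_le_of_forall_lt {n i : ℕ} {q : ℕ → ℕ}
    (hmono : ∀ i j, 1 ≤ i → i < j → j ≤ n → q i < q j) (hi : 1 ≤ i) (hin : i ≤ n) :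
    q i + (n - i) ≤ q n := by
  have key : ∀ m, i + m ≤ n → q i + m ≤ q (i + m) := by
    intro m
    induction m with
    | zero => simp
    | succ m ih =>
      intro h
      have := ih (by omega)
      have := hmono (i + m) (i + (m + 1)) (by omega) (by omega) h
      omega
  simpa [Nat.add_sub_cancel' hin] using key (n - i) (by omega)

theorem mul_le_prod_differences {n : ℕ} (hn : 3 ≤ n) {q : ℕ → ℕ}
    (hmono : ∀ i j, 1 ≤ i → i < j → j ≤ n → q i < q j) :
    (q n - q 1) * (q n - q 2) ≤
      ∏ p ∈ (Finset.Icc 1 n ×ˢ Finset.Icc 1 n).filter (fun p => p.1 < p.2),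
        (q p.2 - q p.1) := by
  rw [← Finset.prod_pair (f := fun p : ℕ × ℕ => q p.2 - q p.1) (a := (1, n)) (b := (2, n))
    (by simp)]
  refine Finset.prod_le_prod_of_subset_of_one_le' ?_ ?_
  · intro p hp
    simp only [Finset.mem_insert, Finset.mem_singleton] at hp
    simp only [Finset.mem_filter, Finset.mem_product, Finset.mem_Icc]
    rcases hp with rfl | rfl <;> simp only <;> omega
  · intro p hp _
    simp only [Finset.mem_filter, Finset.mem_product, Finset.mem_Icc] at hp
    have := hmono p.1 p.2 (by omega) hp.2 (by omega)
    omega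

theorem shifted_product_inequality
    (n : ℕ) (hn : 3 ≤ n) (q : ℕ → ℕ)
    (hpos : ∀ i, 1 ≤ i → i ≤ n → 0 < q i)
    (hmono : ∀ i j, 1 ≤ i → i < j → j ≤ n → q i < q j)
    (hcop : ∀ i j, 1 ≤ i → i < j → j ≤ n → Nat.Coprime (q i) (q j))
    (P : ℕ)
    (hP : P = ∏ p ∈ (Finset.Icc 1 n ×ˢ Finset.Icc 1 n).filter (fun p => p.1 < p.2),
        (q p.2 - q p.1))
    (k : ℕ) (hk1 : 1 < k) (hkn : k < n) :
    (∏ i ∈ Finset.Icc 1 k, (P + q i)) > (∏ j ∈ Finset.Icc (n - k + 2) n, (P + q j)) := by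
  have hPd : (q n - q 1) * (q n - q 2) ≤ P := hP ▸ mul_le_prod_differences hn hmono
  have h1 := add_sub_le_of_forall_lt hmono (le_refl 1) (by omega)
  have h2 := add_sub_le_of_forall_lt hmono (one_le_two) (by omega)
  have hq1 := hpos 1 le_rfl (by omega)
  have hPm : (q n - q 1) * (n - 2) ≤ P :=
    le_trans (Nat.mul_le_mul_left _ (by omega)) hPd
  have hP2 : 2 ≤ P :=
    le_trans (Nat.mul_le_mul (show 2 ≤ q n - q 1 by omega) (show 1 ≤ n - 2 by omega)) hPm
  have hB : (n - 2) * (P + q n) ≤ (n - 2 + 1) * (P + q 1) := by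
    obtain ⟨d, hd⟩ := Nat.exists_eq_add_of_le (show q 1 ≤ q n by omega)
    rw [hd, Nat.add_sub_cancel_left] at hPm
    rw [hd]
    nlinarith
  have hlt := pow_lt_pow_succ_of_mul_le (j := k - 1) (show 3 ≤ P + q 1 by omega)
    (show 0 < n - 2 by omega) (by omega) hB
  have hle {i j : ℕ} (hi : 1 ≤ i) (hij : i ≤ j) (hj : j ≤ n) : q i ≤ q j := by
    rcases hij.eq_or_lt with rfl | h
    · exact le_rfl
    · exact (hmono i j hi h hj).le
  calc ∏ j ∈ Finset.Icc (n - k + 2) n, (P + q j)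
      ≤ (P + q n) ^ (Finset.Icc (n - k + 2) n).card := by
        refine Finset.prod_le_pow_card _ _ _ fun j hj => ?_
        rw [Finset.mem_Icc] at hj
        exact Nat.add_le_add_left (hle (by omega) hj.2 le_rfl) P
    _ = (P + q n) ^ (k - 1) := by
        rw [Nat.card_Icc]
        congr 1
        omega
    _ < (P + q 1) ^ (k - 1 + 1) := hlt
    _ = (P + q 1) ^ (Finset.Icc 1 k).card := by
        rw [Nat.card_Icc]
        congr 1
        omega
    _ ≤ ∏ i ∈ Finset.Icc 1 k, (P + q i) := by
        refine Finset.pow_card_le_prod _ _ _ fun i hi => ?_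
        rw [Finset.mem_Icc] at hi
        exact Nat.add_le_add_left (hle le_rfl hi.1 (by omega)) P
end

section
/- Let $n \geq 4$ and $1 < k < n$ be integers, let $q_1 < \ldots < q_n$ be an increasing sequence of positive integers, and let $P = \prod_{1 \leq i < j \leq n}(q_j - q_i)$. Then $P^{1/k} \cdot (1 + q_1/P) > 1 + q_n/P$ (as real numbers). -/
theorem single_factor_inequality
    (n : ℕ) (hn : 4 ≤ n) (k : ℕ) (hk1 : 1 < k) (hkn : k < n)
    (q : ℕ → ℕ)
    (hpos : ∀ i, 1 ≤ i → i ≤ n → 0 < q i)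
    (hmono : ∀ i j, 1 ≤ i → i < j → j ≤ n → q i < q j)
    (P : ℕ)
    (hP : P = ∏ p ∈ (Finset.Icc 1 n ×ˢ Finset.Icc 1 n).filter (fun p => p.1 < p.2),
        (q p.2 - q p.1)) :
    (P : ℝ) ^ ((1 : ℝ) / (k : ℝ)) * (1 + (q 1 : ℝ) / (P : ℝ)) >
      1 + (q n : ℝ) / (P : ℝ) := by
  have hP0 : 0 < P := by
    rw [hP]
    refine Finset.prod_pos fun p hp => ?_
    simp only [Finset.mem_filter, Finset.mem_product, Finset.mem_Icc] at hp
    have := hmono p.1 p.2 (by omega) (by omega) (by omega)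
    omega
  have hdiam : q n - q 1 ≤ P := by
    refine Nat.le_of_dvd hP0 ?_
    rw [hP]
    refine Finset.dvd_prod_of_mem (fun p : ℕ × ℕ => q p.2 - q p.1) (a := (1, n)) ?_
    simp only [Finset.mem_filter, Finset.mem_product, Finset.mem_Icc]
    omega
  -- The pairs `(i, i + 2)` together with `(1, 4)` give `n - 1` factors that are at least `2`.
  have hpow : 2 ^ (n - 1) ≤ P := by
    let S : Finset (ℕ × ℕ) := insert (1, 4) ((Finset.Icc 1 (n - 2)).image fun i => (i, i + 2))
    have hS : ∀ p ∈ S, 1 ≤ p.1 ∧ p.1 + 2 ≤ p.2 ∧ p.2 ≤ n := by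
      intro p hp
      simp only [S, Finset.mem_insert, Finset.mem_image, Finset.mem_Icc] at hp
      rcases hp with rfl | ⟨i, hi, rfl⟩ <;> dsimp only <;> omega
    have hcard : S.card = n - 1 := by
      rw [Finset.card_insert_of_notMem, Finset.card_image_of_injective, Nat.card_Icc]
      · omega
      · intro i j hij
        exact congrArg Prod.fst hij
      · simp only [Finset.mem_image, Prod.mk.injEq, not_exists, not_and]
        omega
    calc 2 ^ (n - 1) = ∏ _p ∈ S, 2 := by rw [Finset.prod_const, hcard]
      _ ≤ ∏ p ∈ S, (q p.2 - q p.1) := by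
        refine Finset.prod_le_prod (fun _ _ => Nat.zero_le _) fun p hp => ?_
        obtain ⟨h1, h2, h3⟩ := hS p hp
        have := hmono p.1 (p.1 + 1) h1 (by omega) (by omega)
        have := hmono (p.1 + 1) p.2 (by omega) (by omega) h3
        omega
      _ ≤ P := by
        refine Nat.le_of_dvd hP0 ?_
        rw [hP]
        refine Finset.prod_dvd_prod_of_subset _ _ _ fun p hp => ?_
        have := hS p hp
        simp only [Finset.mem_filter, Finset.mem_product, Finset.mem_Icc]
        omega
  have hroot : (2 : ℝ) ≤ (P : ℝ) ^ ((1 : ℝ) / (k : ℝ)) := by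
    have hk : (2 : ℝ) ^ k ≤ P := by
      exact_mod_cast (Nat.pow_le_pow_right (by norm_num) (by omega)).trans hpow
    calc (2 : ℝ) = ((2 : ℝ) ^ k) ^ ((1 : ℝ) / (k : ℝ)) := by
          rw [one_div, Real.pow_rpow_inv_natCast (by norm_num) (by omega)]
      _ ≤ _ := Real.rpow_le_rpow (by positivity) hk (by positivity)
  have hPR : (0 : ℝ) < P := by exact_mod_cast hP0
  have hq : (q n : ℝ) < P + 2 * q 1 := by
    have := hpos 1 le_rfl (by omega)
    exact_mod_cast (by omega : q n < P + 2 * q 1)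
  calc 1 + (q n : ℝ) / P < 1 + (P + 2 * q 1) / P := by gcongr
    _ = 2 * (1 + (q 1 : ℝ) / P) := by field_simp; ring
    _ ≤ _ := by gcongr
end

section
/- Let $q_1 < q_2 < \ldots < q_n$ ($n \geq 3$) be an increasing sequence of pairwise relatively prime positive integers, let $P = \prod_{1 \leq i < j \leq n}(q_j - q_i)$, and let $t \geq 1$ be a positive integer. Then for any $k$ with $1 < k < n$, the sequence $tP+q_1, \ldots, tP+q_n$ is a $(k,n)$-Mignotte sequence; that is, the numbers $tP+q_1 < \ldots < tP+q_n$ are pairwise relatively prime positive integers and $\prod_{i=1}^{k}(tP+q_i) > \prod_{j=n-k+2}^{n}(tP+q_j)$. -/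
/-- Shifting two coprime numbers by a multiple of their difference keeps them coprime. -/
lemma Nat.Coprime.add_left_of_sub_dvd {a b M : ℕ} (h : Nat.Coprime a b)
    (hM : b - a ∣ M) : Nat.Coprime (M + a) (M + b) := by
  refine Nat.Coprime.symm (Nat.coprime_of_dvd fun p hp hpb hpa => ?_)
  have hsub : p ∣ b - a := by
    have := Nat.dvd_sub hpb hpa
    rwa [Nat.add_sub_add_left] at this
  have hpM : p ∣ M := hsub.trans hM
  exact Nat.not_coprime_of_dvd_of_dvd hp.one_lt ((Nat.dvd_add_right hpM).1 hpa)
    ((Nat.dvd_add_right hpM).1 hpb) h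

/-- If all values of `a` on `[1, n]` are within a factor `2` of each other and `2 ^ (k - 1) < a 1`,
then the first `k` values have a larger product than the last `k - 1`. -/
lemma prod_Icc_last_lt_prod_Icc_first {n k : ℕ} (a : ℕ → ℕ) (hk : 1 ≤ k) (hkn : k ≤ n)
    (hpos : ∀ i, 1 ≤ i → i ≤ n → 0 < a i)
    (hle : ∀ i j, 1 ≤ i → i ≤ n → 1 ≤ j → j ≤ n → a j ≤ 2 * a i)
    (hone : 2 ^ (k - 1) < a 1) :
    ∏ j ∈ Finset.Icc (n - k + 2) n, a j < ∏ i ∈ Finset.Icc 1 k, a i := by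
  have hshift : ∏ j ∈ Finset.Icc (n - k + 2) n, a j
      = ∏ i ∈ Finset.Icc 2 k, a (n - k + i) := by
    refine (Finset.prod_nbij (fun i => n - k + i) ?_ ?_ ?_ fun _ _ => rfl).symm
    · intro i hi
      simp only [Finset.mem_Icc] at hi ⊢
      omega
    · intro i _ j _ hij
      exact Nat.add_left_cancel hij
    · intro j hj
      simp only [Finset.coe_Icc, Set.mem_Icc, Set.mem_image] at hj ⊢
      exact ⟨j - (n - k), by omega, by omega⟩
  have hsplit : ∏ i ∈ Finset.Icc 1 k, a i = a 1 * ∏ i ∈ Finset.Icc 2 k, a i := by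
    rw [← Finset.insert_Icc_add_one_left_eq_Icc hk, Finset.prod_insert (by simp), one_add_one_eq_two]
  have hprod : 0 < ∏ i ∈ Finset.Icc 2 k, a i := by
    refine Finset.prod_pos fun i hi => ?_
    simp only [Finset.mem_Icc] at hi
    exact hpos i (by omega) (by omega)
  rw [hshift, hsplit]
  calc ∏ i ∈ Finset.Icc 2 k, a (n - k + i)
      ≤ ∏ i ∈ Finset.Icc 2 k, 2 * a i := by
        refine Finset.prod_le_prod' fun i hi => ?_
        simp only [Finset.mem_Icc] at hi
        exact hle _ _ (by omega) (by omega) (by omega) (by omega)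
    _ = 2 ^ (k - 1) * ∏ i ∈ Finset.Icc 2 k, a i := by
        rw [Finset.prod_mul_distrib, Finset.prod_const, Nat.card_Icc]
        rfl
    _ < a 1 * ∏ i ∈ Finset.Icc 2 k, a i := Nat.mul_lt_mul_of_pos_right hone hprod

/-- The product of all differences of `n` increasing natural numbers is at least `2 ^ (n - 2)`. -/
lemma two_pow_le_prod_sub {n : ℕ} {q : ℕ → ℕ}
    (hmono : ∀ i j, 1 ≤ i → i < j → j ≤ n → q i < q j) :
    2 ^ (n - 2) ≤ ∏ p ∈ (Finset.Icc 1 n ×ˢ Finset.Icc 1 n).filter (fun p => p.1 < p.2),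
        (q p.2 - q p.1) := by
  have hsub : (Finset.Icc 3 n).image (fun j => (1, j)) ⊆
      (Finset.Icc 1 n ×ˢ Finset.Icc 1 n).filter (fun p => p.1 < p.2) := by
    intro p hp
    simp only [Finset.mem_image, Finset.mem_Icc] at hp
    obtain ⟨j, hj, rfl⟩ := hp
    simp only [Finset.mem_filter, Finset.mem_product, Finset.mem_Icc]
    omega
  calc 2 ^ (n - 2) = ∏ _j ∈ Finset.Icc 3 n, 2 := by
        rw [Finset.prod_const, Nat.card_Icc]
        rfl
    _ ≤ ∏ j ∈ Finset.Icc 3 n, (q j - q 1) := by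
        refine Finset.prod_le_prod' fun j hj => ?_
        simp only [Finset.mem_Icc] at hj
        have h₁ := hmono 1 2 (by omega) (by omega) (by omega)
        have h₂ := hmono 2 j (by omega) (by omega) (by omega)
        omega
    _ = ∏ p ∈ (Finset.Icc 3 n).image (fun j => (1, j)), (q p.2 - q p.1) := by
        rw [Finset.prod_image (by simp)]
    _ ≤ _ := by
        refine Finset.prod_le_prod_of_subset_of_one_le' hsub fun p hp _ => ?_
        simp only [Finset.mem_filter, Finset.mem_product, Finset.mem_Icc] at hp
        have := hmono p.1 p.2 (by omega) (by omega) (by omega)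
        omega


theorem iterated_mignotte_construction
    (n : ℕ) (hn : 3 ≤ n) (q : ℕ → ℕ)
    (hpos : ∀ i, 1 ≤ i → i ≤ n → 0 < q i)
    (hmono : ∀ i j, 1 ≤ i → i < j → j ≤ n → q i < q j)
    (hcop : ∀ i j, 1 ≤ i → i < j → j ≤ n → Nat.Coprime (q i) (q j))
    (P : ℕ)
    (hP : P = ∏ p ∈ (Finset.Icc 1 n ×ˢ Finset.Icc 1 n).filter (fun p => p.1 < p.2),
        (q p.2 - q p.1))
    (t : ℕ) (ht : 1 ≤ t)
    (k : ℕ) (hk1 : 1 < k) (hkn : k < n) :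
    (∀ i, 1 ≤ i → i ≤ n → 0 < t * P + q i) ∧
    (∀ i j, 1 ≤ i → i < j → j ≤ n → t * P + q i < t * P + q j) ∧
    (∀ i j, 1 ≤ i → i < j → j ≤ n → Nat.Coprime (t * P + q i) (t * P + q j)) ∧
    (∏ i ∈ Finset.Icc 1 k, (t * P + q i)) >
      (∏ j ∈ Finset.Icc (n - k + 2) n, (t * P + q j)) := by
  have hdvd : ∀ i j, 1 ≤ i → i < j → j ≤ n → q j - q i ∣ P := by
    intro i j hi hij hj
    rw [hP]
    refine Finset.dvd_prod_of_mem (fun p : ℕ × ℕ => q p.2 - q p.1) (a := (i, j)) ?_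
    simp only [Finset.mem_filter, Finset.mem_product, Finset.mem_Icc]
    omega
  have hpow : 2 ^ (n - 2) ≤ P := hP ▸ two_pow_le_prod_sub hmono
  have hPpos : 0 < P := lt_of_lt_of_le (by positivity) hpow
  have hPt : P ≤ t * P := Nat.le_mul_of_pos_left P ht
  refine ⟨fun i hi hin => Nat.add_pos_right _ (hpos i hi hin),
    fun i j hi hij hj => Nat.add_lt_add_left (hmono i j hi hij hj) _,
    fun i j hi hij hj => (hcop i j hi hij hj).add_left_of_sub_dvd
      ((hdvd i j hi hij hj).mul_left t),
    prod_Icc_last_lt_prod_Icc_first (fun i => t * P + q i) hk1.le hkn.le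
      (fun i hi hin => Nat.add_pos_right _ (hpos i hi hin)) ?_ ?_⟩
  · intro i j hi _ _ hjn
    have hq : q j ≤ q i + P := by
      rcases lt_trichotomy i j with h | rfl | h
      · have := Nat.le_of_dvd hPpos (hdvd i j hi h hjn)
        omega
      · omega
      · have := hmono j i (by omega) h (by omega)
        omega
    show t * P + q j ≤ 2 * (t * P + q i)
    omega
  · have h₁ : 2 ^ (k - 1) ≤ 2 ^ (n - 2) := Nat.pow_le_pow_right (by omega) (by omega)
    have h₂ := hpos 1 le_rfl (by omega)
    show 2 ^ (k - 1) < t * P + q 1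
    omega
end
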